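/- Let U₁, U₂ be open neighbourhoods of 0 in R^{2n} ≅ T*R^n with the standard symplectic form, and let κ : U₁ → U₂ be a smooth symplectomorphism with κ(0) = 0. Then there exists a smooth family of symplectomorphisms κ_t : U₁' → U₂ (U₁' a possibly smaller neighbourhood of 0), 0 ≤ t ≤ 1, with κ₀ = id, κ₁ = κ, and κ_t(0) = 0 for all t. -/

import Mathlib

open Set

/-- The standard symplectic form on `T*ℝⁿ = ℝⁿ × ℝⁿ`:
`ω((x,ξ),(y,η)) = ⟨ξ,y⟩ - ⟨x,η⟩`. -/
noncomputable def stdSymp (n : ℕ) (u v : (Fin n → ℝ) × (Fin n → ℝ)) : ℝ :=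
  (∑ i, u.2 i * v.1 i) - ∑ i, u.1 i * v.2 i

lemma stdSymp_add_left (n : ℕ) (u u' v : (Fin n → ℝ) × (Fin n → ℝ)) :
    stdSymp n (u + u') v = stdSymp n u v + stdSymp n u' v := by
  simp only [stdSymp, Prod.fst_add, Prod.snd_add, Pi.add_apply, add_mul, Finset.sum_add_distrib]
  ring

lemma stdSymp_smul_left (n : ℕ) (c : ℝ) (u v : (Fin n → ℝ) × (Fin n → ℝ)) :
    stdSymp n (c • u) v = c * stdSymp n u v := by
  simp only [stdSymp, Prod.smul_fst, Prod.smul_snd, Pi.smul_apply, smul_eq_mul, mul_sub,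
    Finset.mul_sum, mul_assoc]

lemma stdSymp_swap (n : ℕ) (u v : (Fin n → ℝ) × (Fin n → ℝ)) :
    stdSymp n u v = - stdSymp n v u := by
  simp only [stdSymp, neg_sub]
  congr 1 <;> exact Finset.sum_congr rfl fun i _ => mul_comm _ _

lemma stdSymp_self (n : ℕ) (u : (Fin n → ℝ) × (Fin n → ℝ)) : stdSymp n u u = 0 := by
  have := stdSymp_swap n u u
  linarith

lemma stdSymp_add_right (n : ℕ) (u v v' : (Fin n → ℝ) × (Fin n → ℝ)) :
    stdSymp n u (v + v') = stdSymp n u v + stdSymp n u v' := by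
  rw [stdSymp_swap n u, stdSymp_add_left, stdSymp_swap n u v, stdSymp_swap n u v']
  ring

lemma stdSymp_smul_right (n : ℕ) (c : ℝ) (u v : (Fin n → ℝ) × (Fin n → ℝ)) :
    stdSymp n u (c • v) = c * stdSymp n u v := by
  rw [stdSymp_swap n u, stdSymp_smul_left, stdSymp_swap n u v]
  ring

lemma stdSymp_sub_left (n : ℕ) (u u' v : (Fin n → ℝ) × (Fin n → ℝ)) :
    stdSymp n (u - u') v = stdSymp n u v - stdSymp n u' v := by
  have := stdSymp_add_left n (u - u') u' v
  rw [sub_add_cancel] at this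
  linarith

/-- position basis vector -/
def eV (n : ℕ) (i : Fin n) : (Fin n → ℝ) × (Fin n → ℝ) := (Pi.single i 1, 0)
/-- momentum basis vector -/
def fV (n : ℕ) (i : Fin n) : (Fin n → ℝ) × (Fin n → ℝ) := (0, Pi.single i 1)

lemma stdSymp_eV (n : ℕ) (i : Fin n) (w : (Fin n → ℝ) × (Fin n → ℝ)) :
    stdSymp n w (eV n i) = w.2 i := by
  simp [stdSymp, eV, Pi.single_apply]

lemma stdSymp_fV (n : ℕ) (i : Fin n) (w : (Fin n → ℝ) × (Fin n → ℝ)) :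
    stdSymp n w (fV n i) = - w.1 i := by
  simp [stdSymp, fV, Pi.single_apply]

/-- the functional `ω(a, ·)` -/
noncomputable def sympFun (n : ℕ) (a : (Fin n → ℝ) × (Fin n → ℝ)) :
    ((Fin n → ℝ) × (Fin n → ℝ)) →L[ℝ] ℝ :=
  LinearMap.toContinuousLinearMap
    { toFun := stdSymp n a
      map_add' := stdSymp_add_right n a
      map_smul' := fun c v => by simp [stdSymp_smul_right] }

lemma sympFun_apply (n : ℕ) (a v : (Fin n → ℝ) × (Fin n → ℝ)) :
    sympFun n a v = stdSymp n a v := rfl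

/-- symplectic transvection -/
noncomputable def transv (n : ℕ) (a : (Fin n → ℝ) × (Fin n → ℝ)) (c : ℝ) :
    ((Fin n → ℝ) × (Fin n → ℝ)) →L[ℝ] ((Fin n → ℝ) × (Fin n → ℝ)) :=
  ContinuousLinearMap.id ℝ _ + c • (sympFun n a).smulRight a

lemma transv_apply (n : ℕ) (a : (Fin n → ℝ) × (Fin n → ℝ)) (c : ℝ)
    (v : (Fin n → ℝ) × (Fin n → ℝ)) :
    transv n a c v = v + (c * stdSymp n a v) • a := by
  simp [transv, sympFun_apply, mul_smul]

/-- linear symplectic maps -/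
def IsSymp (n : ℕ) (L : ((Fin n → ℝ) × (Fin n → ℝ)) →L[ℝ] ((Fin n → ℝ) × (Fin n → ℝ))) : Prop :=
  ∀ u v, stdSymp n (L u) (L v) = stdSymp n u v

lemma transv_symp (n : ℕ) (a : (Fin n → ℝ) × (Fin n → ℝ)) (c : ℝ) : IsSymp n (transv n a c) := by
  intro u v
  simp only [transv_apply, stdSymp_add_left, stdSymp_add_right, stdSymp_smul_left,
    stdSymp_smul_right, stdSymp_self]
  rw [stdSymp_swap n u a]
  ring

lemma IsSymp.comp {n : ℕ}
    {L M : ((Fin n → ℝ) × (Fin n → ℝ)) →L[ℝ] ((Fin n → ℝ) × (Fin n → ℝ))}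
    (hL : IsSymp n L) (hM : IsSymp n M) : IsSymp n (L.comp M) := by
  intro u v
  simp [hL (M u) (M v), hM u v]

lemma eq_zero_of_stdSymp {n : ℕ} {u : (Fin n → ℝ) × (Fin n → ℝ)}
    (h : ∀ v, stdSymp n u v = 0) : u = 0 := by
  ext i
  · have := h (fV n i)
    rw [stdSymp_fV] at this
    simpa using this
  · have := h (eV n i)
    rw [stdSymp_eV] at this
    simpa using this

lemma IsSymp.injective {n : ℕ}
    {L : ((Fin n → ℝ) × (Fin n → ℝ)) →L[ℝ] ((Fin n → ℝ) × (Fin n → ℝ))}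
    (hL : IsSymp n L) : Function.Injective L := by
  rw [injective_iff_map_eq_zero]
  intro u hu
  apply eq_zero_of_stdSymp
  intro v
  rw [← hL u v, hu]
  simp [stdSymp]

/-- smoothly joined to the identity inside the symplectic group -/
def Good (n : ℕ) (L : ((Fin n → ℝ) × (Fin n → ℝ)) →L[ℝ] ((Fin n → ℝ) × (Fin n → ℝ))) : Prop :=
  ∃ A : ℝ → (((Fin n → ℝ) × (Fin n → ℝ)) →L[ℝ] ((Fin n → ℝ) × (Fin n → ℝ))),
    ContDiff ℝ (⊤ : ℕ∞) A ∧ A 0 = ContinuousLinearMap.id ℝ _ ∧ A 1 = L ∧ ∀ t, IsSymp n (A t)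

lemma good_of_transv {n : ℕ} (a : (Fin n → ℝ) × (Fin n → ℝ)) (c : ℝ)
    {L : ((Fin n → ℝ) × (Fin n → ℝ)) →L[ℝ] ((Fin n → ℝ) × (Fin n → ℝ))}
    (h : Good n ((transv n a c).comp L)) : Good n L := by
  obtain ⟨A, hA, h0, h1, hs⟩ := h
  refine ⟨fun t => (transv n a (-t * c)).comp (A t), ?_, ?_, ?_, fun t => (transv_symp _ _ _).comp (hs t)⟩
  · refine ContDiff.clm_comp ?_ hA
    unfold transv
    fun_prop
  · refine ContinuousLinearMap.ext fun v => ?_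
    simp [h0, transv_apply]
  · refine ContinuousLinearMap.ext fun v => ?_
    simp only [h1, ContinuousLinearMap.comp_apply, transv_apply, stdSymp_add_right,
      stdSymp_smul_right, stdSymp_self]
    module

lemma transv_move {n : ℕ} {u v : (Fin n → ℝ) × (Fin n → ℝ)} (h : stdSymp n u v ≠ 0) :
    ∃ c, transv n (u - v) c u = v := by
  refine ⟨-(stdSymp n u v)⁻¹, ?_⟩
  rw [transv_apply, stdSymp_sub_left, stdSymp_self, stdSymp_swap n v u, zero_sub, neg_neg, neg_mul,
    inv_mul_cancel₀ h]
  module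

lemma transv_fix {n : ℕ} {a v : (Fin n → ℝ) × (Fin n → ℝ)} (c : ℝ) (h : stdSymp n a v = 0) :
    transv n a c v = v := by
  rw [transv_apply, h]; simp

/-- `w` is orthogonal to the basis pairs with index `≥ k`. -/
def InW (n k : ℕ) (w : (Fin n → ℝ) × (Fin n → ℝ)) : Prop :=
  ∀ i : Fin n, k ≤ i.val → stdSymp n w (eV n i) = 0 ∧ stdSymp n w (fV n i) = 0

/-- `L` fixes the basis pairs with index `≥ k`. -/
def Fixes (n k : ℕ) (L : ((Fin n → ℝ) × (Fin n → ℝ)) →L[ℝ] ((Fin n → ℝ) × (Fin n → ℝ))) : Prop :=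
  ∀ i : Fin n, k ≤ i.val → L (eV n i) = eV n i ∧ L (fV n i) = fV n i

lemma InW.add {n k : ℕ} {u v : (Fin n → ℝ) × (Fin n → ℝ)} (hu : InW n k u) (hv : InW n k v) :
    InW n k (u + v) := fun i hi => by
  simp [stdSymp_add_left, hu i hi, hv i hi]

lemma InW.sub {n k : ℕ} {u v : (Fin n → ℝ) × (Fin n → ℝ)} (hu : InW n k u) (hv : InW n k v) :
    InW n k (u - v) := fun i hi => by
  simp [stdSymp_sub_left, hu i hi, hv i hi]

lemma InW.map {n k : ℕ} {u : (Fin n → ℝ) × (Fin n → ℝ)} (hu : InW n k u)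
    {L : ((Fin n → ℝ) × (Fin n → ℝ)) →L[ℝ] ((Fin n → ℝ) × (Fin n → ℝ))}
    (hL : IsSymp n L) (hf : Fixes n k L) : InW n k (L u) := fun i hi => by
  have h1 := hL u (eV n i)
  have h2 := hL u (fV n i)
  rw [(hf i hi).1, (hu i hi).1] at h1
  rw [(hf i hi).2, (hu i hi).2] at h2
  exact ⟨h1, h2⟩

lemma inW_eV {n k : ℕ} {i : Fin n} (hi : i.val < k) : InW n k (eV n i) := fun j hj => by
  have : j ≠ i := by rintro rfl; omega
  rw [stdSymp_eV, stdSymp_fV]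
  simp [eV, this]

lemma inW_fV {n k : ℕ} {i : Fin n} (hi : i.val < k) : InW n k (fV n i) := fun j hj => by
  have : j ≠ i := by rintro rfl; omega
  rw [stdSymp_eV, stdSymp_fV]
  simp [fV, this]

lemma Fixes.transv {n k : ℕ} {a : (Fin n → ℝ) × (Fin n → ℝ)} (ha : InW n k a) (c : ℝ)
    {L : ((Fin n → ℝ) × (Fin n → ℝ)) →L[ℝ] ((Fin n → ℝ) × (Fin n → ℝ))}
    (hf : Fixes n k L) : Fixes n k ((transv n a c).comp L) := fun i hi => by
  simp only [ContinuousLinearMap.comp_apply]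
  rw [(hf i hi).1, (hf i hi).2]
  exact ⟨transv_fix c (ha i hi).1, transv_fix c (ha i hi).2⟩

lemma InW.nondeg {n k : ℕ} {u : (Fin n → ℝ) × (Fin n → ℝ)} (hu : InW n k u) (h0 : u ≠ 0) :
    ∃ w, InW n k w ∧ stdSymp n u w ≠ 0 := by
  by_contra! hcon
  apply h0
  have key : ∀ i : Fin n, stdSymp n u (eV n i) = 0 ∧ stdSymp n u (fV n i) = 0 := by
    intro i
    rcases le_or_gt k i.val with h | h
    · exact hu i h
    · exact ⟨hcon _ (inW_eV h), hcon _ (inW_fV h)⟩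
  ext i
  · have := (key i).2
    rw [stdSymp_fV] at this
    simpa using this
  · have := (key i).1
    rw [stdSymp_eV] at this
    simpa using this

lemma InW.nondeg₂ {n k : ℕ} {u v : (Fin n → ℝ) × (Fin n → ℝ)} (hu : InW n k u) (hu0 : u ≠ 0)
    (hv : InW n k v) (hv0 : v ≠ 0) :
    ∃ w, InW n k w ∧ stdSymp n u w ≠ 0 ∧ stdSymp n v w ≠ 0 := by
  obtain ⟨a, ha, hua⟩ := hu.nondeg hu0
  obtain ⟨b, hb, hvb⟩ := hv.nondeg hv0
  by_cases h1 : stdSymp n v a = 0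
  · by_cases h2 : stdSymp n u b = 0
    · refine ⟨a + b, ha.add hb, ?_, ?_⟩
      · simpa [stdSymp_add_right, h2] using hua
      · simpa [stdSymp_add_right, h1] using hvb
    · exact ⟨b, hb, h2, hvb⟩
  · exact ⟨a, ha, hua, h1⟩

lemma good_of_fixes (n k : ℕ) :
    ∀ L : ((Fin n → ℝ) × (Fin n → ℝ)) →L[ℝ] ((Fin n → ℝ) × (Fin n → ℝ)),
      IsSymp n L → Fixes n k L → Good n L := by
  induction k with
  | zero =>
    intro L hL hf
    have : L = ContinuousLinearMap.id ℝ _ := by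
      refine ContinuousLinearMap.ext fun v => ?_
      rw [← sub_eq_zero]
      have key : ∀ w, InW n 0 w → w = 0 := by
        intro w hw
        by_contra h0
        obtain ⟨w', hw', hne⟩ := hw.nondeg h0
        apply h0
        ext i
        · have := (hw i (Nat.zero_le _)).2
          rw [stdSymp_fV] at this
          simpa using this
        · have := (hw i (Nat.zero_le _)).1
          rw [stdSymp_eV] at this
          simpa using this
      apply key
      intro i hi
      have h1 := hL v (eV n i)
      have h2 := hL v (fV n i)
      rw [(hf i hi).1] at h1
      rw [(hf i hi).2] at h2
      simp [stdSymp_sub_left, h1, h2]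
    refine ⟨fun _ => ContinuousLinearMap.id ℝ _, contDiff_const, rfl, this.symm, fun t u v => rfl⟩
  | succ k ih =>
    intro L hL hf
    by_cases hk : n ≤ k
    · exact ih L hL fun i hi => absurd i.isLt (by omega)
    push Not at hk
    set e := eV n ⟨k, hk⟩ with he
    set f := fV n ⟨k, hk⟩ with hfdef
    have heW : InW n (k + 1) e := inW_eV (by simp)
    have hfW : InW n (k + 1) f := inW_fV (by simp)
    have hfe : stdSymp n f e = 1 := by rw [he, stdSymp_eV]; simp [hfdef, fV]
    have hef : stdSymp n e f = -1 := by rw [stdSymp_swap, hfe]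
    have he0 : e ≠ 0 := by
      intro h
      rw [h] at hef
      simp [stdSymp] at hef
    -- B1
    have B1 : ∀ L, IsSymp n L → Fixes n (k + 1) L → L e = e → stdSymp n (L f) f ≠ 0 →
        Good n L := by
      intro L hL hf hLe hne
      obtain ⟨c, hc⟩ := transv_move hne
      have haW : InW n (k + 1) (L f - f) := (hfW.map hL hf).sub hfW
      apply good_of_transv (L f - f) c
      apply ih _ ((transv_symp _ _ _).comp hL)
      have hfix := hf.transv haW c
      intro i hi
      rcases Nat.eq_or_lt_of_le hi with h | h
      · have : i = ⟨k, hk⟩ := Fin.ext h.symm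
        subst this
        refine ⟨?_, hc⟩
        change transv n (L f - f) c (L e) = e
        rw [hLe]
        apply transv_fix
        have := hL f e
        rw [hLe] at this
        rw [stdSymp_sub_left, this, sub_self]
      · exact hfix i h
    have B2 : ∀ L, IsSymp n L → Fixes n (k + 1) L → L e = e → Good n L := by
      intro L hL hf hLe
      by_cases hne : stdSymp n (L f) f = 0
      · have h1 : stdSymp n (L f) e = 1 := by
          have := hL f e
          rw [hLe] at this
          rw [this, hfe]
        have h2 : stdSymp n (L f) (e + f) ≠ 0 := by
          rw [stdSymp_add_right, h1, hne]; norm_num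
        obtain ⟨c, hc⟩ := transv_move h2
        have haW : InW n (k + 1) (L f - (e + f)) := (hfW.map hL hf).sub (heW.add hfW)
        apply good_of_transv (L f - (e + f)) c
        apply B1 _ ((transv_symp _ _ _).comp hL) (hf.transv haW c)
        · change transv n _ c (L e) = e
          rw [hLe]
          apply transv_fix
          rw [stdSymp_sub_left, stdSymp_add_left, h1, hfe, stdSymp_self]; norm_num
        · change stdSymp n (transv n _ c (L f)) f ≠ 0
          rw [hc, stdSymp_add_left, hef, stdSymp_self]; norm_num
      · exact B1 L hL hf hLe hne
    have A1 : ∀ L, IsSymp n L → Fixes n (k + 1) L → stdSymp n (L e) e ≠ 0 → Good n L := by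
      intro L hL hf hne
      obtain ⟨c, hc⟩ := transv_move hne
      have haW : InW n (k + 1) (L e - e) := (heW.map hL hf).sub heW
      apply good_of_transv (L e - e) c
      exact B2 _ ((transv_symp _ _ _).comp hL) (hf.transv haW c) hc
    have hLe0 : L e ≠ 0 := fun h => he0 (hL.injective (by rw [h, map_zero]))
    obtain ⟨w, hw, hw1, hw2⟩ := (heW.map hL hf).nondeg₂ hLe0 heW he0
    obtain ⟨c, hc⟩ := transv_move hw1
    apply good_of_transv (L e - w) c
    apply A1 _ ((transv_symp _ _ _).comp hL) (hf.transv ((heW.map hL hf).sub hw) c)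
    change stdSymp n (transv n _ c (L e)) e ≠ 0
    rw [hc, stdSymp_swap]
    exact neg_ne_zero.mpr hw2

lemma good_of_symp (n : ℕ)
    (L : ((Fin n → ℝ) × (Fin n → ℝ)) →L[ℝ] ((Fin n → ℝ) × (Fin n → ℝ)))
    (hL : IsSymp n L) : Good n L :=
  good_of_fixes n n L hL fun i hi => absurd i.isLt (by omega)

/-- A smooth symplectic path from the inverse of `L` to the identity. -/
lemma exists_path (n : ℕ)
    (L : ((Fin n → ℝ) × (Fin n → ℝ)) →L[ℝ] ((Fin n → ℝ) × (Fin n → ℝ)))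
    (hL : IsSymp n L) :
    ∃ A : ℝ → (((Fin n → ℝ) × (Fin n → ℝ)) →L[ℝ] ((Fin n → ℝ) × (Fin n → ℝ))),
      ContDiff ℝ (⊤ : ℕ∞) A ∧ (∀ x, A 0 (L x) = x) ∧ (∀ x, A 1 x = x) ∧ ∀ t, IsSymp n (A t) := by
  let e := LinearEquiv.ofInjectiveEndo L.toLinearMap hL.injective
  have he : ∀ x, e x = L x := fun x => rfl
  let M : ((Fin n → ℝ) × (Fin n → ℝ)) →L[ℝ] ((Fin n → ℝ) × (Fin n → ℝ)) :=
    LinearMap.toContinuousLinearMap e.symm.toLinearMap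
  have hM : ∀ x, M x = e.symm x := fun x => rfl
  have hMs : IsSymp n M := by
    intro u v
    rw [← hL (M u) (M v), ← he, ← he, hM, hM]
    simp
  obtain ⟨B, hB, h0, h1, hs⟩ := good_of_symp n M hMs
  refine ⟨fun t => B (1 - t), hB.comp (contDiff_const.sub contDiff_id), ?_, ?_, fun t => hs _⟩
  · intro x
    simp only [sub_zero, h1, hM, ← he]
    simp
  · intro x
    simp [h0]

lemma contDiff_param_aux {P : Type} [NormedAddCommGroup P] [NormedSpace ℝ P] [ProperSpace P]
    (m : ℕ) : ∀ (F : Type) [NormedAddCommGroup F] [NormedSpace ℝ F] (g : P × ℝ → F),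
    ContDiff ℝ (⊤ : ℕ∞) g → ContDiff ℝ m (fun p => ∫ s in (0:ℝ)..1, g (p, s)) := by
  induction m with
  | zero =>
    intro F _ _ g hg
    simp only [Nat.cast_zero, contDiff_zero]
    exact intervalIntegral.continuous_parametric_intervalIntegral_of_continuous'
      (f := fun p s => g (p, s)) hg.continuous 0 1
  | succ m ih =>
    intro F _ _ g hg
    have hg' : ContDiff ℝ (⊤ : ℕ∞) (fun q : P × ℝ =>
        (fderiv ℝ g q).comp (ContinuousLinearMap.inl ℝ P ℝ)) :=
      (hg.fderiv_right (m := (⊤ : ℕ∞)) (by simp)).clm_comp contDiff_const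
    push_cast
    rw [contDiff_succ_iff_hasFDerivAt]
    refine ⟨_, ih _ _ hg', ?_⟩
    intro p₀
    have hcomp : IsCompact (Metric.closedBall p₀ 1 ×ˢ Icc (0:ℝ) 1) :=
      (isCompact_closedBall p₀ 1).prod isCompact_Icc
    obtain ⟨C, hC⟩ := hcomp.exists_bound_of_continuousOn hg'.continuous.continuousOn
    refine intervalIntegral.hasFDerivAt_integral_of_dominated_of_fderiv_le
      (F := fun p s => g (p, s))
      (F' := fun p s => (fderiv ℝ g (p, s)).comp (ContinuousLinearMap.inl ℝ P ℝ))
      (μ := MeasureTheory.volume) (a := 0) (b := 1) (bound := fun _ => C)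
      (Metric.closedBall_mem_nhds p₀ one_pos) ?_ ?_ ?_ ?_ ?_ ?_
    · refine Filter.Eventually.of_forall fun p => ?_
      exact (hg.continuous.comp (by fun_prop : Continuous fun s : ℝ => (p, s))).aestronglyMeasurable
    · exact (hg.continuous.comp (by fun_prop : Continuous fun s : ℝ => (p₀, s))).intervalIntegrable _ _
    · exact (hg'.continuous.comp
        (by fun_prop : Continuous fun s : ℝ => (p₀, s))).aestronglyMeasurable
    · refine Filter.Eventually.of_forall fun s hs p hp => ?_
      rw [uIoc_of_le zero_le_one] at hs
      exact hC (p, s) ⟨hp, hs.1.le, hs.2⟩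
    · exact intervalIntegrable_const
    · refine Filter.Eventually.of_forall fun s _ p _ => ?_
      have h1 : HasFDerivAt g (fderiv ℝ g (p, s)) (p, s) :=
        (hg.differentiable (by simp) _).hasFDerivAt
      exact h1.comp p (hasFDerivAt_prodMk_left p s)

lemma contDiff_param {P : Type} [NormedAddCommGroup P] [NormedSpace ℝ P] [ProperSpace P]
    {F : Type} [NormedAddCommGroup F] [NormedSpace ℝ F] (g : P × ℝ → F)
    (hg : ContDiff ℝ (⊤ : ℕ∞) g) :
    ContDiff ℝ (⊤ : ℕ∞) (fun p => ∫ s in (0:ℝ)..1, g (p, s)) :=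
  contDiff_infty.2 fun m => contDiff_param_aux m F g hg

/-- Hadamard's lemma in the form needed. -/
lemma exists_hadamard {V : Type} [NormedAddCommGroup V] [NormedSpace ℝ V] [FiniteDimensional ℝ V]
    (k : V → V) (hk : ContDiff ℝ (⊤ : ℕ∞) k) (h0 : k 0 = 0) :
    ∃ G : ℝ × V → V, ContDiff ℝ (⊤ : ℕ∞) G ∧ (∀ x, G (0, x) = fderiv ℝ k 0 x) ∧
      ∀ t x, t • G (t, x) = k (t • x) := by
  have : ProperSpace V := FiniteDimensional.proper ℝ V
  have hd : ContDiff ℝ (⊤ : ℕ∞) (fderiv ℝ k) := hk.fderiv_right (by simp)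
  refine ⟨fun p => ∫ s in (0:ℝ)..1, (fun q : (ℝ × V) × ℝ =>
    fderiv ℝ k ((q.2 * q.1.1) • q.1.2) q.1.2) (p, s), contDiff_param (fun q : (ℝ × V) × ℝ =>
    fderiv ℝ k ((q.2 * q.1.1) • q.1.2) q.1.2) ?_, ?_, ?_⟩
  · refine ContDiff.clm_apply (hd.comp ?_) ?_ <;> fun_prop
  · intro x
    simp
  · intro t x
    simp only
    rw [← intervalIntegral.integral_smul]
    have : ∀ s ∈ uIcc (0:ℝ) 1, HasDerivAt (fun s : ℝ => k ((s * t) • x))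
        (t • fderiv ℝ k ((s * t) • x) x) s := by
      intro s _
      have h1 : HasFDerivAt k (fderiv ℝ k ((s * t) • x)) ((s * t) • x) :=
        (hk.differentiable (by simp) _).hasFDerivAt
      have h2 : HasDerivAt (fun s : ℝ => (s * t) • x) (t • x) s := by
        simpa using ((hasDerivAt_id s).mul_const t).smul_const x
      have := h1.comp_hasDerivAt s h2
      rw [map_smul] at this
      exact this
    rw [intervalIntegral.integral_eq_sub_of_hasDerivAt this]
    · simp [h0]
    · apply Continuous.intervalIntegrable
      refine continuous_const.smul (Continuous.clm_apply (hd.continuous.comp ?_) ?_) <;> fun_prop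

lemma exists_global_ext {V : Type} [NormedAddCommGroup V] [NormedSpace ℝ V]
    [FiniteDimensional ℝ V] (U : Set V) (hU : IsOpen U) (h0 : (0 : V) ∈ U) (κ : V → V)
    (hκ : ContDiffOn ℝ (⊤ : ℕ∞) κ U) :
    ∃ k : V → V, ContDiff ℝ (⊤ : ℕ∞) k ∧ ∃ r > 0, Metric.ball 0 r ⊆ U ∧
      ∀ x ∈ Metric.ball (0 : V) r, k x = κ x := by
  obtain ⟨R, hR, hRU⟩ := Metric.nhds_basis_closedBall.mem_iff.1 (hU.mem_nhds h0)
  let f : ContDiffBump (0 : V) := ⟨R / 2, R, by positivity, by linarith⟩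
  refine ⟨fun x => f x • κ x, ?_, R / 2, by positivity, ?_, ?_⟩
  · rw [contDiff_iff_contDiffAt]
    intro x
    by_cases hx : x ∈ U
    · exact f.contDiff.contDiffAt.smul (hκ.contDiffAt (hU.mem_nhds hx))
    · have : x ∉ tsupport f := by
        rw [f.tsupport_eq]
        exact fun h => hx (hRU h)
      have h2 := notMem_tsupport_iff_eventuallyEq.1 this
      refine (contDiffAt_const (c := (0 : V))).congr_of_eventuallyEq ?_
      filter_upwards [h2] with y hy
      simp [hy]
  · exact (Metric.ball_subset_closedBall.trans
      (Metric.closedBall_subset_closedBall (by linarith))).trans hRU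
  · intro x hx
    have : f x = 1 := f.one_of_mem_closedBall (Metric.ball_subset_closedBall hx)
    simp [this]

/-- Deformation of a symplectomorphism fixing the origin to the identity
(Lemma `l:well` of the paper): any smooth symplectomorphism `κ : U₁ → U₂` of
neighbourhoods of `0` in `T*ℝⁿ` with `κ(0) = 0` embeds (after shrinking `U₁`)
in a smooth family `κ_t`, `0 ≤ t ≤ 1`, of symplectomorphisms into `U₂` with
`κ₀ = id`, `κ₁ = κ`, `κ_t(0) = 0`. -/
theorem stmt_6 (n : ℕ) (U₁ U₂ : Set ((Fin n → ℝ) × (Fin n → ℝ)))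
    (hU₁ : IsOpen U₁) (hU₂ : IsOpen U₂) (h0₁ : (0 : (Fin n → ℝ) × (Fin n → ℝ)) ∈ U₁)
    (h0₂ : (0 : (Fin n → ℝ) × (Fin n → ℝ)) ∈ U₂)
    (κ : (Fin n → ℝ) × (Fin n → ℝ) → (Fin n → ℝ) × (Fin n → ℝ))
    (hκsmooth : ContDiffOn ℝ (⊤ : ℕ∞) κ U₁) (hκ0 : κ 0 = 0)
    (hκmaps : MapsTo κ U₁ U₂) (hκinj : InjOn κ U₁)
    (hκsymp : ∀ x ∈ U₁, ∀ u v, stdSymp n (fderiv ℝ κ x u) (fderiv ℝ κ x v) = stdSymp n u v) :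
    ∃ U₁' : Set ((Fin n → ℝ) × (Fin n → ℝ)), IsOpen U₁' ∧
      (0 : (Fin n → ℝ) × (Fin n → ℝ)) ∈ U₁' ∧ U₁' ⊆ U₁ ∧
      ∃ K : ℝ → (Fin n → ℝ) × (Fin n → ℝ) → (Fin n → ℝ) × (Fin n → ℝ),
        ContDiffOn ℝ (⊤ : ℕ∞) (fun p => K p.1 p.2) (Icc (0:ℝ) 1 ×ˢ U₁') ∧
        (∀ x ∈ U₁', K 0 x = x) ∧ (∀ x ∈ U₁', K 1 x = κ x) ∧
        ∀ t ∈ Icc (0:ℝ) 1,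
          K t 0 = 0 ∧ MapsTo (K t) U₁' U₂ ∧ InjOn (K t) U₁' ∧
          ∀ x ∈ U₁', ∀ u v,
            stdSymp n (fderiv ℝ (K t) x u) (fderiv ℝ (K t) x v) = stdSymp n u v := by
  obtain ⟨k, hk, r, hr, hrU, hkκ⟩ := exists_global_ext U₁ hU₁ h0₁ κ hκsmooth
  have hk0 : k 0 = 0 := by rw [hkκ 0 (Metric.mem_ball_self hr), hκ0]
  have hnear : ∀ x ∈ Metric.ball (0 : (Fin n → ℝ) × (Fin n → ℝ)) r, fderiv ℝ k x = fderiv ℝ κ x := by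
    intro x hx
    apply Filter.EventuallyEq.fderiv_eq
    filter_upwards [Metric.isOpen_ball.mem_nhds hx] with y hy using hkκ y hy
  have hks : ∀ x ∈ Metric.ball (0 : (Fin n → ℝ) × (Fin n → ℝ)) r, IsSymp n (fderiv ℝ k x) := by
    intro x hx u v
    rw [hnear x hx]
    exact hκsymp x (hrU hx) u v
  obtain ⟨A, hA, hA0, hA1, hAs⟩ := exists_path n _ (hks 0 (Metric.mem_ball_self hr))
  obtain ⟨G, hG, hG0, hGt⟩ := exists_hadamard k hk hk0
  have hK : ContDiff ℝ (⊤ : ℕ∞)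
      (fun p : ℝ × ((Fin n → ℝ) × (Fin n → ℝ)) => A p.1 (G p)) :=
    (hA.comp contDiff_fst).clm_apply hG
  have hKG0 : ∀ t, G (t, 0) = 0 := by
    intro t
    rcases eq_or_ne t 0 with rfl | ht
    · rw [hG0, map_zero]
    · have := hGt t 0
      rw [smul_zero, hk0] at this
      exact (smul_eq_zero.1 this).resolve_left ht
  have hGd : ∀ t ∈ Icc (0:ℝ) 1, ∀ x,
      HasFDerivAt (fun x => G (t, x)) (fderiv ℝ k (t • x)) x := by
    intro t _ x
    rcases eq_or_ne t 0 with rfl | ht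
    · have : (fun x => G (0, x)) = fun x => fderiv ℝ k 0 x := funext hG0
      rw [this, zero_smul]
      exact (fderiv ℝ k 0).hasFDerivAt
    · have : (fun x => G (t, x)) = fun x => t⁻¹ • k (t • x) := by
        funext x
        rw [← hGt, smul_smul, inv_mul_cancel₀ ht, one_smul]
      rw [this]
      have h1 : HasFDerivAt k (fderiv ℝ k (t • x)) (t • x) :=
        (hk.differentiable (by simp) _).hasFDerivAt
      have h2 := (h1.comp x ((hasFDerivAt_id x).const_smul t)).const_smul t⁻¹
      refine h2.congr_fderiv ?_
      refine ContinuousLinearMap.ext fun v => ?_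
      simp [smul_smul, inv_mul_cancel₀ ht]
  have hball : ∀ t ∈ Icc (0:ℝ) 1, ∀ x ∈ Metric.ball (0 : (Fin n → ℝ) × (Fin n → ℝ)) r,
      t • x ∈ Metric.ball (0 : (Fin n → ℝ) × (Fin n → ℝ)) r := by
    intro t ht x hx
    rw [mem_ball_zero_iff] at hx ⊢
    rw [norm_smul, Real.norm_of_nonneg ht.1]
    exact (mul_le_of_le_one_left (norm_nonneg _) ht.2).trans_lt hx
  have htube : ∀ᶠ x in nhds (0 : (Fin n → ℝ) × (Fin n → ℝ)), ∀ t ∈ Icc (0:ℝ) 1,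
      A t (G (t, x)) ∈ U₂ := by
    apply isCompact_Icc.eventually_forall_of_forall_eventually
    intro t _
    have hc : Continuous (fun z : ((Fin n → ℝ) × (Fin n → ℝ)) × ℝ => A z.2 (G (z.2, z.1))) :=
      hK.continuous.comp (by fun_prop : Continuous
        fun z : ((Fin n → ℝ) × (Fin n → ℝ)) × ℝ => (z.2, z.1))
    apply hc.continuousAt.eventually_mem
    apply hU₂.mem_nhds
    simpa [hKG0] using h0₂
  obtain ⟨δ, hδ, hδU⟩ := Metric.nhds_basis_ball.mem_iff.1
    (Filter.inter_mem htube (Metric.ball_mem_nhds 0 hr))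
  refine ⟨Metric.ball 0 δ, Metric.isOpen_ball, Metric.mem_ball_self hδ,
    fun x hx => hrU (hδU hx).2, fun t x => A t (G (t, x)), hK.contDiffOn, ?_, ?_, ?_⟩
  · intro x _
    simp only [hG0, hA0]
  · intro x hx
    have := hGt 1 x
    rw [one_smul, one_smul] at this
    simp only [hA1, this]
    exact hkκ x (hδU hx).2
  · intro t ht
    refine ⟨by simp [hKG0], fun x hx => (hδU hx).1 t ht, ?_, ?_⟩
    · intro x hx y hy hxy
      have h1 : G (t, x) = G (t, y) := (hAs t).injective hxy
      rcases eq_or_ne t 0 with rfl | h0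
      · rw [hG0, hG0] at h1
        exact (hks 0 (Metric.mem_ball_self hr)).injective h1
      · have h2 : k (t • x) = k (t • y) := by rw [← hGt, ← hGt, h1]
        have hx' := hball t ht x (hδU hx).2
        have hy' := hball t ht y (hδU hy).2
        rw [hkκ _ hx', hkκ _ hy'] at h2
        exact smul_right_injective _ h0 (hκinj (hrU hx') (hrU hy') h2)
    · intro x hx u v
      have hd : HasFDerivAt (fun x => A t (G (t, x))) ((A t).comp (fderiv ℝ k (t • x))) x :=
        (A t).hasFDerivAt.comp x (hGd t ht x)
      rw [hd.fderiv]
      exact ((hAs t).comp (hks _ (hball t ht x (hδU hx).2))) u v
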